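/- Let a₁, a₂, a₃ > 0 and β ∈ [0, π], and let (ω_b, ω_t) be a gap of Σ(β) of type (iii). Then F_β(ω) → 0 as ω → ω_b from the right with ω ∈ (ω_b, ω_t), and limsup_{ω → ω_t⁻, ω ∈ (ω_b, ω_t)} (1 − F_β(ω)) ≤ 0. -/

import Mathlib

open Real MeasureTheory Set Filter Topology

noncomputable section

/-- The dispersion relation `D_β(ω, k₁, k₂)`. -/
def Dfun (a₁ a₂ a₃ β ω k₁ k₂ : ℝ) : ℝ :=
  Real.sin (ω * a₂) * Real.sin (ω * a₃) * (Real.cos (ω * a₁) - Real.cos k₁)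
    + Real.sin (ω * a₃) * Real.sin (ω * a₁) * (Real.cos (ω * a₂) - Real.cos k₂)
    + Real.sin (ω * a₁) * Real.sin (ω * a₂) * (Real.cos (ω * a₃) - Real.cos β)

/-- The dispersion set `Σ(β)`. -/
def dispSet (a₁ a₂ a₃ β : ℝ) : Set ℝ :=
  {ω | 0 < ω ∧ ∃ k₁ ∈ Icc (0 : ℝ) π, ∃ k₂ ∈ Icc (0 : ℝ) π, Dfun a₁ a₂ a₃ β ω k₁ k₂ = 0}

/-- `φ_β(ω) = (cos(ω a₃) − cos β)/sin(ω a₃)`. -/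
def phiB (a₃ β ω : ℝ) : ℝ := (Real.cos (ω * a₃) - Real.cos β) / Real.sin (ω * a₃)

/-- `f(ξ, η, ω)`. -/
def fFun (a₁ a₂ ξ η ω : ℝ) : ℝ :=
  (Real.cos ξ - Real.cos (ω * a₁)) / Real.sin (ω * a₁)
    + (Real.cos η - Real.cos (ω * a₂)) / Real.sin (ω * a₂)

/-- `g_β(ω)`. -/
def gB (a₁ a₂ a₃ β ω : ℝ) : ℝ :=
  Real.cos (ω * a₁) / Real.sin (ω * a₁) + Real.cos (ω * a₂) / Real.sin (ω * a₂)
    + phiB a₃ β ω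

/-- The set `T = {πn/a₁ : n ≥ 1} ∪ {πn/a₂ : n ≥ 1}`. -/
def Tset (a₁ a₂ : ℝ) : Set ℝ :=
  {x | ∃ n : ℕ, 1 ≤ n ∧ x = π * n / a₁} ∪ {x | ∃ n : ℕ, 1 ≤ n ∧ x = π * n / a₂}

/-- The set `𝒲(β)`. -/
def Wset (a₃ β : ℝ) : Set ℝ :=
  if β = 0 ∨ β = π then
    {x | ∃ n : ℕ, 1 ≤ n ∧ x = β / a₃ + (2 * n + 1) * π / a₃}
  else
    {x | ∃ n : ℕ, 1 ≤ n ∧ x = π * n / a₃}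

/-- `(ω_b, ω_t)` is a gap of the dispersion set `Σ(β)`. -/
def IsGap (a₁ a₂ a₃ β ωb ωt : ℝ) : Prop :=
  0 < ωb ∧ ωb < ωt ∧ ωb ∈ dispSet a₁ a₂ a₃ β ∧ ωt ∈ dispSet a₁ a₂ a₃ β ∧
    Ioo ωb ωt ∩ dispSet a₁ a₂ a₃ β = ∅

/-- The finite-difference system (FD). -/
def SatisfiesFD (a₁ a₂ a₃ β μ ω : ℝ) (u : ℤ × ℤ → ℂ) : Prop :=
  (∀ k ℓ : ℤ, (k, ℓ) ≠ ((0 : ℤ), (0 : ℤ)) →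
    u (k + 1, ℓ) / (Real.sin (ω * a₁) : ℂ) + u (k - 1, ℓ) / (Real.sin (ω * a₁) : ℂ)
      + u (k, ℓ + 1) / (Real.sin (ω * a₂) : ℂ) + u (k, ℓ - 1) / (Real.sin (ω * a₂) : ℂ)
      - 2 * (gB a₁ a₂ a₃ β ω : ℂ) * u (k, ℓ) = 0)
  ∧ u (1, 0) / (Real.sin (ω * a₁) : ℂ) + u (-1, 0) / (Real.sin (ω * a₁) : ℂ)
      + u (0, 1) / (Real.sin (ω * a₂) : ℂ) + u (0, -1) / (Real.sin (ω * a₂) : ℂ)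
      - 2 * (gB a₁ a₂ a₃ β ω : ℂ) * u (0, 0)
      = 2 * ((μ - 1 : ℝ) : ℂ) * (phiB a₃ β ω : ℂ) * u (0, 0)

/-- `I_β(ω) = (1/(4π²)) ∫_{(0,2π)²} φ_β(ω)/(φ_β(ω) − f(ξ,η,ω)) dξ dη`. -/
def IB (a₁ a₂ a₃ β ω : ℝ) : ℝ :=
  (1 / (4 * π ^ 2)) *
    ∫ p in (Ioo (0 : ℝ) (2 * π)) ×ˢ (Ioo (0 : ℝ) (2 * π)),
      phiB a₃ β ω / (phiB a₃ β ω - fFun a₁ a₂ p.1 p.2 ω)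

/-- `F_β(ω) = I_β(ω)⁻¹`. -/
def FB (a₁ a₂ a₃ β ω : ℝ) : ℝ := (IB a₁ a₂ a₃ β ω)⁻¹

/-- The function `(b − cos x)/sin x`; `φ_β` and `f` are built from it. -/
def cosQuot (b x : ℝ) : ℝ := (b - Real.cos x) / Real.sin x

/-- The difference `f − φ_β`, as a function of `u = cos ξ` and `v = cos η`. -/
def symbolDiff (a₁ a₂ a₃ β ω u v : ℝ) : ℝ :=
  cosQuot u (ω * a₁) + cosQuot v (ω * a₂) + cosQuot (Real.cos β) (ω * a₃)

lemma IB_eq (a₁ a₂ a₃ β ω : ℝ) : IB a₁ a₂ a₃ β ω = (1 / (4 * π ^ 2)) *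
    ∫ p in (Ioo (0 : ℝ) (2 * π)) ×ˢ (Ioo (0 : ℝ) (2 * π)), cosQuot (Real.cos β) (ω * a₃) /
      symbolDiff a₁ a₂ a₃ β ω (Real.cos p.1) (Real.cos p.2) := by
  unfold IB
  congr 2
  ext p
  have h : phiB a₃ β ω = -cosQuot (Real.cos β) (ω * a₃) := by
    unfold phiB cosQuot; rw [← neg_div]; congr 1; ring
  rw [h, ← neg_div_neg_eq]
  congr 1
  · ring
  · unfold symbolDiff fFun cosQuot; ring

lemma eventually_sin_mul_ne_zero {a : ℝ} (ha : a ≠ 0) (x : ℝ) :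
    ∀ᶠ ω in 𝓝[≠] x, Real.sin (ω * a) ≠ 0 := by
  by_cases h : Real.sin (x * a) = 0
  · have hd : HasDerivAt (fun ω : ℝ => Real.sin (ω * a)) (Real.cos (x * a) * a) x := by
      simpa using ((hasDerivAt_id x).mul_const a).sin
    refine hd.eventually_ne (mul_ne_zero ?_ ha)
    intro hc
    have := Real.sin_sq_add_cos_sq (x * a)
    simp [h, hc] at this
  · have hc : ContinuousAt (fun ω : ℝ => Real.sin (ω * a)) x := by fun_prop
    exact (hc.eventually_ne h).filter_mono nhdsWithin_le_nhds

lemma symbolDiff_ne_zero {a₁ a₂ a₃ β ω u v : ℝ} (hω : 0 < ω) (h : ω ∉ dispSet a₁ a₂ a₃ β)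
    (h₁ : Real.sin (ω * a₁) ≠ 0) (h₂ : Real.sin (ω * a₂) ≠ 0) (h₃ : Real.sin (ω * a₃) ≠ 0)
    (hu : u ∈ Icc (-1 : ℝ) 1) (hv : v ∈ Icc (-1 : ℝ) 1) :
    symbolDiff a₁ a₂ a₃ β ω u v ≠ 0 := by
  intro h0
  refine h ⟨hω, Real.arccos u, ⟨Real.arccos_nonneg _, Real.arccos_le_pi _⟩, Real.arccos v,
    ⟨Real.arccos_nonneg _, Real.arccos_le_pi _⟩, ?_⟩
  unfold Dfun
  rw [Real.cos_arccos hu.1 hu.2, Real.cos_arccos hv.1 hv.2]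
  unfold symbolDiff cosQuot at h0
  field_simp at h0
  linear_combination -h0

lemma IsPreconnected.forall_pos_or_forall_neg {X : Type*} [TopologicalSpace X] {s : Set X}
    (hs : IsPreconnected s) {g : X → ℝ} (hg : ContinuousOn g s) (h0 : ∀ x ∈ s, g x ≠ 0) :
    (∀ x ∈ s, 0 < g x) ∨ (∀ x ∈ s, g x < 0) := by
  by_contra! hcon
  obtain ⟨⟨x, hx, hgx⟩, y, hy, hgy⟩ := hcon
  obtain ⟨z, hz, hz0⟩ := hs.intermediate_value hx hy hg ⟨hgx, hgy⟩
  exact h0 z hz hz0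

lemma exists_sign_symbolDiff {a₁ a₂ a₃ β l r : ℝ}
    (h₁ : ∀ ω ∈ Ioo l r, Real.sin (ω * a₁) ≠ 0) (h₂ : ∀ ω ∈ Ioo l r, Real.sin (ω * a₂) ≠ 0)
    (h₃ : ∀ ω ∈ Ioo l r, Real.sin (ω * a₃) ≠ 0)
    (hG : ∀ ω ∈ Ioo l r, ∀ u ∈ Icc (-1 : ℝ) 1, ∀ v ∈ Icc (-1 : ℝ) 1,
      symbolDiff a₁ a₂ a₃ β ω u v ≠ 0) :
    ∃ σ : ℝ, (σ = 1 ∨ σ = -1) ∧ ∀ ω ∈ Ioo l r, ∀ u ∈ Icc (-1 : ℝ) 1, ∀ v ∈ Icc (-1 : ℝ) 1,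
      0 < σ * symbolDiff a₁ a₂ a₃ β ω u v := by
  have hs : IsPreconnected (Ioo l r ×ˢ Icc (-1 : ℝ) 1 ×ˢ Icc (-1 : ℝ) 1) :=
    isPreconnected_Ioo.prod (isPreconnected_Icc.prod isPreconnected_Icc)
  have hc : ContinuousOn (fun p : ℝ × ℝ × ℝ => symbolDiff a₁ a₂ a₃ β p.1 p.2.1 p.2.2)
      (Ioo l r ×ˢ Icc (-1 : ℝ) 1 ×ˢ Icc (-1 : ℝ) 1) := by
    unfold symbolDiff cosQuot
    refine ((ContinuousOn.div ?_ ?_ ?_).add (ContinuousOn.div ?_ ?_ ?_)).add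
      (ContinuousOn.div ?_ ?_ ?_)
    any_goals fun_prop
    · exact fun p hp => h₁ _ hp.1
    · exact fun p hp => h₂ _ hp.1
    · exact fun p hp => h₃ _ hp.1
  rcases hs.forall_pos_or_forall_neg hc (fun p hp => hG _ hp.1 _ hp.2.1 _ hp.2.2) with h | h
  · exact ⟨1, Or.inl rfl, fun ω hω u hu v hv => by
      rw [one_mul]; exact h (ω, u, v) ⟨hω, hu, hv⟩⟩
  · exact ⟨-1, Or.inr rfl, fun ω hω u hu v hv => by
      rw [neg_one_mul, neg_pos]; exact h (ω, u, v) ⟨hω, hu, hv⟩⟩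

lemma sign_mul_cosQuot_pos {a₁ a₂ a₃ β ω σ : ℝ}
    (h : ∀ u ∈ Icc (-1 : ℝ) 1, ∀ v ∈ Icc (-1 : ℝ) 1, 0 < σ * symbolDiff a₁ a₂ a₃ β ω u v) :
    0 < σ * cosQuot (Real.cos β) (ω * a₃) := by
  simpa [symbolDiff, cosQuot] using h _ (cos_mem_Icc (ω * a₁)) _ (cos_mem_Icc (ω * a₂))

lemma ratio_pos {a₁ a₂ a₃ β ω σ : ℝ}
    (h : ∀ u ∈ Icc (-1 : ℝ) 1, ∀ v ∈ Icc (-1 : ℝ) 1, 0 < σ * symbolDiff a₁ a₂ a₃ β ω u v)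
    (p : ℝ × ℝ) : 0 < cosQuot (Real.cos β) (ω * a₃) /
      symbolDiff a₁ a₂ a₃ β ω (Real.cos p.1) (Real.cos p.2) := by
  have h1 := sign_mul_cosQuot_pos h
  have h2 := h _ (cos_mem_Icc p.1) _ (cos_mem_Icc p.2)
  have hσ : σ ≠ 0 := by rintro rfl; simp at h1
  rw [← mul_div_mul_left _ _ hσ]
  exact div_pos h1 h2

lemma continuous_symbolDiff_cos (a₁ a₂ a₃ β ω : ℝ) : Continuous fun p : ℝ × ℝ =>
    symbolDiff a₁ a₂ a₃ β ω (Real.cos p.1) (Real.cos p.2) := by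
  unfold symbolDiff cosQuot; fun_prop

lemma integrableOn_ratio {a₁ a₂ a₃ β ω σ : ℝ}
    (h : ∀ u ∈ Icc (-1 : ℝ) 1, ∀ v ∈ Icc (-1 : ℝ) 1, 0 < σ * symbolDiff a₁ a₂ a₃ β ω u v) :
    IntegrableOn (fun p : ℝ × ℝ => cosQuot (Real.cos β) (ω * a₃) /
      symbolDiff a₁ a₂ a₃ β ω (Real.cos p.1) (Real.cos p.2))
      ((Ioo (0 : ℝ) (2 * π)) ×ˢ (Ioo (0 : ℝ) (2 * π))) := by
  have hc : Continuous (fun p : ℝ × ℝ => cosQuot (Real.cos β) (ω * a₃) /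
      symbolDiff a₁ a₂ a₃ β ω (Real.cos p.1) (Real.cos p.2)) := by
    refine continuous_const.div (continuous_symbolDiff_cos _ _ _ _ _) fun p hp => ?_
    have h2 := h _ (cos_mem_Icc p.1) _ (cos_mem_Icc p.2)
    simp [hp] at h2
  exact (hc.continuousOn.integrableOn_compact (isCompact_Icc.prod isCompact_Icc)).mono_set
    (prod_mono Ioo_subset_Icc_self Ioo_subset_Icc_self)

lemma measurableSet_square :
    MeasurableSet ((Ioo (0 : ℝ) (2 * π)) ×ˢ (Ioo (0 : ℝ) (2 * π))) :=
  measurableSet_Ioo.prod measurableSet_Ioo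

lemma volume_square_ne_top :
    volume ((Ioo (0 : ℝ) (2 * π)) ×ˢ (Ioo (0 : ℝ) (2 * π))) ≠ ⊤ := by
  rw [Measure.volume_eq_prod, Measure.prod_prod]
  simp [ENNReal.mul_eq_top]

lemma volume_real_square :
    volume.real ((Ioo (0 : ℝ) (2 * π)) ×ˢ (Ioo (0 : ℝ) (2 * π))) = 4 * π ^ 2 := by
  rw [Measure.volume_eq_prod, measureReal_def, Measure.prod_prod]
  simp [Real.pi_pos.le]
  ring

lemma IB_pos {a₁ a₂ a₃ β ω σ : ℝ}
    (h : ∀ u ∈ Icc (-1 : ℝ) 1, ∀ v ∈ Icc (-1 : ℝ) 1, 0 < σ * symbolDiff a₁ a₂ a₃ β ω u v) :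
    0 < IB a₁ a₂ a₃ β ω := by
  rw [IB_eq]
  refine mul_pos (by positivity) ?_
  rw [setIntegral_pos_iff_support_of_nonneg_ae
    (Eventually.of_forall fun p => (ratio_pos h p).le) (integrableOn_ratio h)]
  have : Function.support (fun p : ℝ × ℝ => cosQuot (Real.cos β) (ω * a₃) /
      symbolDiff a₁ a₂ a₃ β ω (Real.cos p.1) (Real.cos p.2)) = univ :=
    eq_univ_of_forall fun p => (ratio_pos h p).ne'
  rw [this, univ_inter, Measure.volume_eq_prod, Measure.prod_prod]
  simp [Real.pi_pos]

lemma lintegral_const_mul_inv_eq_top {c r : ℝ} (k : ℝ) (hc : 0 < c) (hr : 0 < r) :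
    ∫⁻ x in Ioo k (k + r), ENNReal.ofReal (c * (x - k)⁻¹) = ⊤ := by
  by_contra hne
  have hfin : HasFiniteIntegral (fun x => c * (x - k)⁻¹) (volume.restrict (Ioo k (k + r))) := by
    rw [hasFiniteIntegral_iff_ofReal]
    · exact lt_top_iff_ne_top.2 hne
    · refine (ae_restrict_iff' measurableSet_Ioo).2 (Eventually.of_forall fun x hx => ?_)
      have : 0 < x - k := sub_pos.2 hx.1
      simp only [Pi.zero_apply]
      positivity
  have hint : IntegrableOn (fun x => c * (x - k)⁻¹) (Ioo k (k + r)) :=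
    ⟨by fun_prop, hfin⟩
  have h2 : IntervalIntegrable (fun x => c * (x - k)⁻¹) volume k (k + r) := by
    rwa [intervalIntegrable_iff_integrableOn_Ioo_of_le (by linarith)]
  refine not_intervalIntegrable_of_sub_inv_isBigO_punctured (c := k) ?_ (by linarith)
    left_mem_uIcc h2
  exact Asymptotics.isBigO_self_const_mul hc.ne' _ _

lemma lintegral_corner_eq_top {q : ℝ × ℝ → ENNReal} (hq : Measurable q) {k l c r : ℝ}
    (hc : 0 < c) (hr : 0 < r)
    (h : ∀ x ∈ Ioo k (k + r), ∀ y ∈ Ioo l (l + (x - k)),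
      ENNReal.ofReal (c / (x - k) ^ 2) ≤ q (x, y)) :
    ∫⁻ p in Ioo k (k + r) ×ˢ Ioo l (l + r), q p = ⊤ := by
  rw [Measure.volume_eq_prod, ← Measure.prod_restrict, lintegral_prod _ hq.aemeasurable,
    ← top_le_iff, ← lintegral_const_mul_inv_eq_top k hc hr]
  refine setLIntegral_mono' measurableSet_Ioo fun x hx => ?_
  have hx0 : 0 < x - k := sub_pos.2 hx.1
  calc ENNReal.ofReal (c * (x - k)⁻¹)
      = ∫⁻ _ in Ioo l (l + (x - k)), ENNReal.ofReal (c / (x - k) ^ 2) := by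
        rw [setLIntegral_const, Real.volume_Ioo, ← ENNReal.ofReal_mul (by positivity)]
        congr 1
        field_simp
        ring
    _ ≤ ∫⁻ y in Ioo l (l + (x - k)), q (x, y) :=
        setLIntegral_mono' measurableSet_Ioo fun y hy => h x hx y hy
    _ ≤ ∫⁻ y in Ioo l (l + r), q (x, y) :=
        lintegral_mono_set (Ioo_subset_Ioo_right (by linarith [hx.2]))

lemma sin_eq_zero_of_extremal {κ k : ℝ} (hκ : κ ≠ 0)
    (h : ∀ u ∈ Icc (-1 : ℝ) 1, 0 ≤ κ * (u - Real.cos k)) : Real.sin k = 0 := by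
  have h1 := h 1 (by norm_num)
  have h2 := h (-1) (by norm_num)
  have h3 := Real.sin_sq_add_cos_sq k
  have h4 := Real.cos_le_one k
  have h5 := Real.neg_one_le_cos k
  have : Real.cos k = 1 ∨ Real.cos k = -1 := by
    rcases hκ.lt_or_gt with h6 | h6
    · exact Or.inl (by nlinarith)
    · exact Or.inr (by nlinarith)
  rcases this with h | h <;> rw [h] at h3 <;> exact pow_eq_zero_iff two_ne_zero |>.1 (by linarith)

lemma cos_eq_mul_of_sin_eq_zero {k : ℝ} (hk : Real.sin k = 0) (x : ℝ) :
    Real.cos x = Real.cos k * Real.cos (x - k) := by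
  have h := Real.cos_add k (x - k)
  rw [hk, add_sub_cancel] at h
  linarith

lemma cos_sq_eq_one_of_sin_eq_zero {k : ℝ} (hk : Real.sin k = 0) : Real.cos k ^ 2 = 1 := by
  have := Real.sin_sq_add_cos_sq k
  rw [hk] at this
  linarith

lemma abs_cos_sub_cos_le {k : ℝ} (hk : Real.sin k = 0) (x : ℝ) :
    |Real.cos x - Real.cos k| ≤ (x - k) ^ 2 / 2 := by
  have hc : |Real.cos k| = 1 := by
    rw [← sq_eq_sq₀ (abs_nonneg _) zero_le_one, sq_abs, cos_sq_eq_one_of_sin_eq_zero hk, one_pow]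
  have h1 := Real.one_sub_sq_div_two_le_cos (x := x - k)
  have h2 := Real.cos_le_one (x - k)
  rw [cos_eq_mul_of_sin_eq_zero hk x,
    show Real.cos k * Real.cos (x - k) - Real.cos k = Real.cos k * (Real.cos (x - k) - 1) by ring,
    abs_mul, hc, one_mul, abs_sub_comm, abs_of_nonneg (by linarith)]
  linarith

lemma cos_ne_cos_of_mem_Ioo {k x : ℝ} (hk : Real.sin k = 0) (hx : x ∈ Ioo k (k + π)) :
    Real.cos x ≠ Real.cos k := by
  intro h
  have hc := cos_sq_eq_one_of_sin_eq_zero hk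
  rw [cos_eq_mul_of_sin_eq_zero hk x] at h
  have hk0 : Real.cos k ≠ 0 := by rintro h0; simp [h0] at hc
  have h1 : Real.cos (x - k) = 1 := mul_left_cancel₀ hk0 (by rw [h, mul_one])
  have h2 := Real.cos_lt_cos_of_nonneg_of_le_pi le_rfl (by linarith [hx.2] : x - k ≤ π)
    (sub_pos.2 hx.1)
  rw [h1, Real.cos_zero] at h2
  exact lt_irrefl _ h2

lemma continuousAt_cosQuot {a b ω : ℝ} (h : Real.sin (ω * a) ≠ 0) :
    ContinuousAt (fun ω => cosQuot b (ω * a)) ω := by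
  unfold cosQuot
  exact ContinuousAt.div (by fun_prop) (by fun_prop) h

lemma continuousAt_symbolDiff {a₁ a₂ a₃ β ω : ℝ} (h₁ : Real.sin (ω * a₁) ≠ 0)
    (h₂ : Real.sin (ω * a₂) ≠ 0) (h₃ : Real.sin (ω * a₃) ≠ 0) (u v : ℝ) :
    ContinuousAt (fun ω => symbolDiff a₁ a₂ a₃ β ω u v) ω :=
  ((continuousAt_cosQuot h₁).add (continuousAt_cosQuot h₂)).add (continuousAt_cosQuot h₃)

lemma measurable_ofReal_ratio (a₁ a₂ a₃ β ω : ℝ) : Measurable fun p : ℝ × ℝ =>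
    ENNReal.ofReal (cosQuot (Real.cos β) (ω * a₃) /
      symbolDiff a₁ a₂ a₃ β ω (Real.cos p.1) (Real.cos p.2)) :=
  (measurable_const.div (continuous_symbolDiff_cos _ _ _ _ _).measurable).ennreal_ofReal

/-- At a band edge where the symbol has an extremal zero, the ratio is not integrable: the zero is
of second order and the domain is two-dimensional. -/
lemma lintegral_ratio_eq_top {a₁ a₂ a₃ β ω σ k₁ k₂ : ℝ}
    (h₁ : Real.sin (ω * a₁) ≠ 0) (h₂ : Real.sin (ω * a₂) ≠ 0) (hσ : σ ≠ 0)
    (hk₁ : k₁ ∈ Icc (0 : ℝ) π) (hk₂ : k₂ ∈ Icc (0 : ℝ) π)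
    (h0 : symbolDiff a₁ a₂ a₃ β ω (Real.cos k₁) (Real.cos k₂) = 0)
    (hnn : ∀ u ∈ Icc (-1 : ℝ) 1, ∀ v ∈ Icc (-1 : ℝ) 1, 0 ≤ σ * symbolDiff a₁ a₂ a₃ β ω u v) :
    ∫⁻ p in (Ioo (0 : ℝ) (2 * π)) ×ˢ (Ioo (0 : ℝ) (2 * π)),
      ENNReal.ofReal (cosQuot (Real.cos β) (ω * a₃) /
        symbolDiff a₁ a₂ a₃ β ω (Real.cos p.1) (Real.cos p.2)) = ⊤ := by
  set κ₁ := σ / Real.sin (ω * a₁) with hκ₁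
  set κ₂ := σ / Real.sin (ω * a₂) with hκ₂
  have hκ₁0 : κ₁ ≠ 0 := div_ne_zero hσ h₁
  have hκ₂0 : κ₂ ≠ 0 := div_ne_zero hσ h₂
  have hG : ∀ u v, σ * symbolDiff a₁ a₂ a₃ β ω u v
      = κ₁ * (u - Real.cos k₁) + κ₂ * (v - Real.cos k₂) := by
    intro u v
    rw [← sub_zero (symbolDiff a₁ a₂ a₃ β ω u v), ← h0, hκ₁, hκ₂]
    unfold symbolDiff cosQuot
    ring
  have hx : ∀ u ∈ Icc (-1 : ℝ) 1, 0 ≤ κ₁ * (u - Real.cos k₁) := fun u hu => by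
    simpa [hG] using hnn u hu _ (Real.cos_mem_Icc k₂)
  have hy : ∀ v ∈ Icc (-1 : ℝ) 1, 0 ≤ κ₂ * (v - Real.cos k₂) := fun v hv => by
    simpa [hG] using hnn _ (Real.cos_mem_Icc k₁) v hv
  have hs₁ := sin_eq_zero_of_extremal hκ₁0 hx
  have hs₂ := sin_eq_zero_of_extremal hκ₂0 hy
  have hP : 0 < σ * cosQuot (Real.cos β) (ω * a₃) := by
    have e : σ * cosQuot (Real.cos β) (ω * a₃)
        = σ * symbolDiff a₁ a₂ a₃ β ω (Real.cos (ω * a₁)) (Real.cos (ω * a₂)) := by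
      simp [symbolDiff, cosQuot]
    rw [e, hG]
    refine add_pos_of_pos_of_nonneg ((hx _ (Real.cos_mem_Icc _)).lt_of_ne'
      (mul_ne_zero hκ₁0 (sub_ne_zero.2 fun h => ?_))) (hy _ (Real.cos_mem_Icc _))
    have e1 := Real.sin_sq_add_cos_sq (ω * a₁)
    rw [h, cos_sq_eq_one_of_sin_eq_zero hs₁] at e1
    exact h₁ (pow_eq_zero_iff two_ne_zero |>.1 (by linarith))
  have hK : 0 < (|κ₁| + |κ₂|) / 2 := by positivity
  rw [← top_le_iff]
  refine le_trans (le_of_eq (lintegral_corner_eq_top (measurable_ofReal_ratio a₁ a₂ a₃ β ω)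
    (k := k₁) (l := k₂) (div_pos hP hK) Real.pi_pos fun x hxk y hyk => ?_).symm)
    (lintegral_mono_set (prod_mono
      (Ioo_subset_Ioo hk₁.1 (by linarith [hk₁.2])) (Ioo_subset_Ioo hk₂.1 (by linarith [hk₂.2]))))
  refine ENNReal.ofReal_le_ofReal ?_
  have hd : 0 < x - k₁ := sub_pos.2 hxk.1
  have hd' : 0 < y - k₂ := sub_pos.2 hyk.1
  have hd'' : y - k₂ < x - k₁ := by linarith [hyk.2]
  have hpos : 0 < σ * symbolDiff a₁ a₂ a₃ β ω (Real.cos x) (Real.cos y) := by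
    rw [hG]
    exact add_pos_of_pos_of_nonneg ((hx _ (Real.cos_mem_Icc _)).lt_of_ne'
      (mul_ne_zero hκ₁0 (sub_ne_zero.2 (cos_ne_cos_of_mem_Ioo hs₁ hxk)))) (hy _ (Real.cos_mem_Icc _))
  rw [← mul_div_mul_left (cosQuot _ _) _ hσ, div_div]
  refine div_le_div_of_nonneg_left hP.le hpos ?_
  rw [hG]
  calc κ₁ * (Real.cos x - Real.cos k₁) + κ₂ * (Real.cos y - Real.cos k₂)
      ≤ |κ₁| * |Real.cos x - Real.cos k₁| + |κ₂| * |Real.cos y - Real.cos k₂| := by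
        rw [← abs_mul, ← abs_mul]
        exact add_le_add (le_abs_self _) (le_abs_self _)
    _ ≤ |κ₁| * ((x - k₁) ^ 2 / 2) + |κ₂| * ((x - k₁) ^ 2 / 2) := by
        gcongr
        · exact abs_cos_sub_cos_le hs₁ x
        · refine (abs_cos_sub_cos_le hs₂ y).trans ?_
          gcongr
    _ = (|κ₁| + |κ₂|) / 2 * (x - k₁) ^ 2 := by ring

lemma tendsto_FB_nhdsGT {a₁ a₂ a₃ β ωb r σ k₁ k₂ : ℝ} (hr : ωb < r)
    (h₁ : Real.sin (ωb * a₁) ≠ 0) (h₂ : Real.sin (ωb * a₂) ≠ 0) (h₃ : Real.sin (ωb * a₃) ≠ 0)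
    (hσ : σ ≠ 0) (hk₁ : k₁ ∈ Icc (0 : ℝ) π) (hk₂ : k₂ ∈ Icc (0 : ℝ) π)
    (h0 : symbolDiff a₁ a₂ a₃ β ωb (Real.cos k₁) (Real.cos k₂) = 0)
    (hpos : ∀ ω ∈ Ioo ωb r, ∀ u ∈ Icc (-1 : ℝ) 1, ∀ v ∈ Icc (-1 : ℝ) 1,
      0 < σ * symbolDiff a₁ a₂ a₃ β ω u v) :
    Tendsto (fun ω => FB a₁ a₂ a₃ β ω) (𝓝[>] ωb) (𝓝 0) := by
  have hev : ∀ᶠ ω in 𝓝[>] ωb, ω ∈ Ioo ωb r := Ioo_mem_nhdsGT hr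
  have hnn : ∀ u ∈ Icc (-1 : ℝ) 1, ∀ v ∈ Icc (-1 : ℝ) 1,
      0 ≤ σ * symbolDiff a₁ a₂ a₃ β ωb u v := fun u hu v hv =>
    ge_of_tendsto
      (((continuousAt_symbolDiff h₁ h₂ h₃ u v).tendsto.mono_left nhdsWithin_le_nhds).const_mul σ)
      (hev.mono fun ω hω => (hpos ω hω u hu v hv).le)
  have htop := lintegral_ratio_eq_top h₁ h₂ hσ hk₁ hk₂ h0 hnn
  have hlim : Tendsto (fun ω => ∫⁻ p in (Ioo (0 : ℝ) (2 * π)) ×ˢ (Ioo (0 : ℝ) (2 * π)),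
      ENNReal.ofReal (cosQuot (Real.cos β) (ω * a₃) /
        symbolDiff a₁ a₂ a₃ β ω (Real.cos p.1) (Real.cos p.2))) (𝓝[>] ωb) (𝓝 ⊤) := by
    refine tendsto_of_le_liminf_of_limsup_le ?_ le_top
    rw [← htop]
    refine le_trans (lintegral_mono fun p => ?_)
      (lintegral_liminf_le fun ω => measurable_ofReal_ratio a₁ a₂ a₃ β ω)
    by_cases hp : symbolDiff a₁ a₂ a₃ β ωb (Real.cos p.1) (Real.cos p.2) = 0
    · simp [hp]
    · refine (Tendsto.liminf_eq (ENNReal.tendsto_ofReal ?_)).ge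
      exact ((continuousAt_cosQuot h₃).div (continuousAt_symbolDiff h₁ h₂ h₃ _ _) hp).tendsto.mono_left
        nhdsWithin_le_nhds
  have hint : Tendsto (fun ω => ∫ p in (Ioo (0 : ℝ) (2 * π)) ×ˢ (Ioo (0 : ℝ) (2 * π)),
      cosQuot (Real.cos β) (ω * a₃) /
        symbolDiff a₁ a₂ a₃ β ω (Real.cos p.1) (Real.cos p.2)) (𝓝[>] ωb) atTop := by
    rw [← ENNReal.tendsto_ofReal_nhds_top]
    refine hlim.congr' (hev.mono fun ω hω => ?_)
    exact (ofReal_integral_eq_lintegral_ofReal (integrableOn_ratio (hpos ω hω))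
      (Eventually.of_forall fun p => (ratio_pos (hpos ω hω) p).le)).symm
  refine tendsto_inv_atTop_zero.comp ?_
  exact (hint.const_mul_atTop (by positivity)).congr fun ω => (IB_eq a₁ a₂ a₃ β ω).symm

lemma tendsto_cosQuot_of_cos_eq {a b ω : ℝ} (hs : Real.sin (ω * a) = 0)
    (hb : Real.cos (ω * a) = b) : Tendsto (fun t => cosQuot b (t * a)) (𝓝 ω) (𝓝 0) := by
  have hb2 : b ^ 2 = 1 := hb ▸ cos_sq_eq_one_of_sin_eq_zero hs
  have hb0 : b + b ≠ 0 := by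
    intro h
    have : b = 0 := by linarith
    simp [this] at hb2
  have hne : ∀ᶠ t in 𝓝 ω, b + Real.cos (t * a) ≠ 0 := by
    have hc : ContinuousAt (fun t : ℝ => b + Real.cos (t * a)) ω := by fun_prop
    exact hc.eventually_ne (by rw [hb]; exact hb0)
  have hlim : Tendsto (fun t => Real.sin (t * a) / (b + Real.cos (t * a))) (𝓝 ω) (𝓝 0) := by
    have hc : ContinuousAt (fun t => Real.sin (t * a) / (b + Real.cos (t * a))) ω :=
      ContinuousAt.div (by fun_prop) (by fun_prop) (by rw [hb]; exact hb0)
    have := hc.tendsto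
    rwa [hs, zero_div] at this
  refine hlim.congr' (hne.mono fun t ht => ?_)
  by_cases h : Real.sin (t * a) = 0
  · simp [cosQuot, h]
  · simp only [cosQuot]
    rw [div_eq_div_iff ht h]
    linear_combination Real.sin_sq_add_cos_sq (t * a) - hb2

lemma exists_cosQuot_pos {x : ℝ} (hx : Real.sin x ≠ 0) :
    ∃ b ∈ Icc (-1 : ℝ) 1, -b ∈ Icc (-1 : ℝ) 1 ∧ 0 < cosQuot b x ∧ cosQuot (-b) x < 0 := by
  have h := Real.sin_sq_add_cos_sq x
  have hp : 0 < Real.sin x ^ 2 := by positivity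
  have h1 : Real.cos x < 1 := by nlinarith [Real.cos_le_one x, Real.neg_one_le_cos x]
  have h2 : -1 < Real.cos x := by nlinarith [Real.cos_le_one x, Real.neg_one_le_cos x]
  rcases hx.lt_or_gt with h3 | h3
  · exact ⟨-1, by norm_num, by norm_num, div_pos_of_neg_of_neg (by linarith) h3,
      div_neg_of_pos_of_neg (by linarith) h3⟩
  · exact ⟨1, by norm_num, by norm_num, div_pos (by linarith) h3,
      div_neg_of_neg_of_pos (by linarith) h3⟩

lemma sin_third_ne_zero {a₁ a₂ a₃ β ωb r σ k₁ k₂ : ℝ} (hr : ωb < r)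
    (h₁ : Real.sin (ωb * a₁) ≠ 0) (h₂ : Real.sin (ωb * a₂) ≠ 0)
    (hD : Dfun a₁ a₂ a₃ β ωb k₁ k₂ = 0)
    (hpos : ∀ ω ∈ Ioo ωb r, ∀ u ∈ Icc (-1 : ℝ) 1, ∀ v ∈ Icc (-1 : ℝ) 1,
      0 < σ * symbolDiff a₁ a₂ a₃ β ω u v) : Real.sin (ωb * a₃) ≠ 0 := by
  intro h₃
  have hcos : Real.cos (ωb * a₃) = Real.cos β := by
    simpa [Dfun, h₁, h₂, h₃, sub_eq_zero] using hD
  have hp := tendsto_cosQuot_of_cos_eq h₃ hcos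
  obtain ⟨u, hu, hu', hup, hun⟩ := exists_cosQuot_pos h₁
  obtain ⟨v, hv, hv', hvp, hvn⟩ := exists_cosQuot_pos h₂
  have hlim : ∀ u v, Tendsto (fun ω => symbolDiff a₁ a₂ a₃ β ω u v) (𝓝[>] ωb)
      (𝓝 (cosQuot u (ωb * a₁) + cosQuot v (ωb * a₂) + 0)) := fun u v =>
    Tendsto.mono_left (((continuousAt_cosQuot h₁).tendsto.add
      (continuousAt_cosQuot h₂).tendsto).add hp) nhdsWithin_le_nhds
  have e1 := (hlim u v).eventually_const_lt (show (0 : ℝ) < _ by linarith)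
  have e2 := (hlim (-u) (-v)).eventually_lt_const (show _ < (0 : ℝ) by linarith)
  have hJ : ∀ᶠ ω in 𝓝[>] ωb, ω ∈ Ioo ωb r := Ioo_mem_nhdsGT hr
  obtain ⟨ω, hω, hω1, hω2⟩ := (hJ.and (e1.and e2)).exists
  have p1 := hpos ω hω u hu v hv
  have p2 := hpos ω hω _ hu' _ hv'
  nlinarith [pos_of_mul_pos_left p1 hω1.le]

lemma monotoneOn_cosQuot {a b l r : ℝ} (ha : 0 < a) (hb : b ∈ Icc (-1 : ℝ) 1)
    (h : ∀ ω ∈ Ioo l r, Real.sin (ω * a) ≠ 0) :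
    MonotoneOn (fun ω => cosQuot b (ω * a)) (Ioo l r) := by
  have hd : ∀ ω ∈ Ioo l r, HasDerivAt (fun ω => cosQuot b (ω * a))
      (a * (1 - b * Real.cos (ω * a)) / Real.sin (ω * a) ^ 2) ω := by
    intro ω hω
    have e := (hasDerivAt_id ω).mul_const a
    have := (e.cos.const_sub b).div e.sin (h ω hω)
    refine this.congr_deriv ?_
    simp only [id_eq]
    congr 1
    linear_combination a * Real.sin_sq_add_cos_sq (ω * a)
  refine monotoneOn_of_deriv_nonneg (convex_Ioo l r)
    (fun ω hω => (hd ω hω).continuousAt.continuousWithinAt) ?_ ?_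
  · rw [interior_Ioo]
    exact fun ω hω => (hd ω hω).differentiableAt.differentiableWithinAt
  · rw [interior_Ioo]
    intro ω hω
    rw [(hd ω hω).deriv]
    have h1 : b * Real.cos (ω * a) ≤ 1 := by
      refine (le_abs_self _).trans ?_
      rw [abs_mul]
      exact mul_le_one₀ (abs_le.2 hb) (abs_nonneg _) (Real.abs_cos_le_one _)
    have : 0 ≤ 1 - b * Real.cos (ω * a) := by linarith
    positivity

lemma eventually_cosQuot_ge {a b l r : ℝ} (ha : 0 < a) (hb : b ∈ Icc (-1 : ℝ) 1)
    (h : ∀ ω ∈ Ioo l r, Real.sin (ω * a) ≠ 0) {ω₁ : ℝ} (hω₁ : ω₁ ∈ Ioo l r) :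
    ∀ᶠ ω in 𝓝[<] r, cosQuot b (ω₁ * a) ≤ cosQuot b (ω * a) := by
  filter_upwards [Ioo_mem_nhdsLT hω₁.2] with ω hω
  exact monotoneOn_cosQuot ha hb h hω₁ ⟨hω₁.1.trans hω.1, hω.2⟩ hω.1.le

lemma tendsto_cosQuot_atTop {a b l r : ℝ} (ha : 0 < a) (hb : b ∈ Icc (-1 : ℝ) 1)
    (h : ∀ ω ∈ Ioo l r, Real.sin (ω * a) ≠ 0) (hlr : l < r) (hs : Real.sin (r * a) = 0)
    (hc : Real.cos (r * a) ≠ b) :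
    Tendsto (fun ω => cosQuot b (ω * a)) (𝓝[<] r) atTop := by
  have hden : Tendsto (fun ω => |Real.sin (ω * a)|) (𝓝[<] r) (𝓝[>] 0) := by
    refine tendsto_nhdsWithin_iff.2 ⟨?_, ?_⟩
    · have hcont : ContinuousAt (fun ω => |Real.sin (ω * a)|) r := by fun_prop
      have := hcont.tendsto
      rw [hs, abs_zero] at this
      exact this.mono_left nhdsWithin_le_nhds
    · filter_upwards [Ioo_mem_nhdsLT hlr] with ω hω
      exact abs_pos.2 (h ω hω)
  have hnum : Tendsto (fun ω => |b - Real.cos (ω * a)|) (𝓝[<] r) (𝓝 |b - Real.cos (r * a)|) := by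
    have hcont : ContinuousAt (fun ω => |b - Real.cos (ω * a)|) r := by fun_prop
    exact hcont.tendsto.mono_left nhdsWithin_le_nhds
  have habs : Tendsto (fun ω => |cosQuot b (ω * a)|) (𝓝[<] r) atTop := by
    refine (hnum.pos_mul_atTop (abs_pos.2 (sub_ne_zero.2 hc.symm))
      hden.inv_tendsto_nhdsGT_zero).congr fun ω => ?_
    rw [cosQuot, abs_div, div_eq_mul_inv]
    rfl
  have hmid : (l + r) / 2 ∈ Ioo l r := ⟨by linarith, by linarith⟩
  refine tendsto_atTop.2 fun M => ?_
  filter_upwards [habs.eventually_ge_atTop M,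
    habs.eventually_gt_atTop (-cosQuot b ((l + r) / 2 * a)),
    eventually_cosQuot_ge ha hb h hmid] with ω h1 h2 h3
  rcases abs_cases (cosQuot b (ω * a)) with ⟨h4, _⟩ | ⟨h4, _⟩ <;> linarith

lemma tendsto_symbolDiff_atTop {a₁ a₂ a₃ β l r u v : ℝ} (ha₁ : 0 < a₁) (ha₂ : 0 < a₂)
    (ha₃ : 0 < a₃) (hlr : l < r) (h₁ : ∀ ω ∈ Ioo l r, Real.sin (ω * a₁) ≠ 0)
    (h₂ : ∀ ω ∈ Ioo l r, Real.sin (ω * a₂) ≠ 0) (h₃ : ∀ ω ∈ Ioo l r, Real.sin (ω * a₃) ≠ 0)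
    (hu : u ∈ Icc (-1 : ℝ) 1) (hv : v ∈ Icc (-1 : ℝ) 1)
    (hs : Real.sin (r * a₁) = 0 ∨ Real.sin (r * a₂) = 0) (hu2 : u ^ 2 ≠ 1) (hv2 : v ^ 2 ≠ 1) :
    Tendsto (fun ω => symbolDiff a₁ a₂ a₃ β ω u v) (𝓝[<] r) atTop := by
  have hmid : (l + r) / 2 ∈ Ioo l r := ⟨by linarith, by linarith⟩
  refine tendsto_atTop_add_right_of_le' _ _ ?_
    (eventually_cosQuot_ge ha₃ (Real.cos_mem_Icc β) h₃ hmid)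
  rcases hs with hs | hs
  · refine tendsto_atTop_add_right_of_le' _ _ (tendsto_cosQuot_atTop ha₁ hu h₁ hlr hs ?_)
      (eventually_cosQuot_ge ha₂ hv h₂ hmid)
    rintro rfl
    exact hu2 (cos_sq_eq_one_of_sin_eq_zero hs)
  · refine tendsto_atTop_add_left_of_le' _ _ (eventually_cosQuot_ge ha₁ hu h₁ hmid)
      (tendsto_cosQuot_atTop ha₂ hv h₂ hlr hs ?_)
    rintro rfl
    exact hv2 (cos_sq_eq_one_of_sin_eq_zero hs)

lemma abs_cosQuot_le {b : ℝ} (hb : b ∈ Icc (-1 : ℝ) 1) (x : ℝ) :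
    |cosQuot b x| ≤ 2 / |Real.sin x| := by
  rw [cosQuot, abs_div]
  gcongr
  exact abs_le.2 ⟨by linarith [hb.1, Real.cos_le_one x], by linarith [hb.2, Real.neg_one_le_cos x]⟩

lemma ae_sin_ne_zero : ∀ᵐ x : ℝ, Real.sin x ≠ 0 := by
  have hc : {x : ℝ | Real.sin x = 0}.Countable := by
    refine (countable_range fun n : ℤ => (n : ℝ) * π).mono fun x hx => ?_
    exact Real.sin_eq_zero_iff.1 hx
  exact hc.ae_notMem volume

lemma cos_sq_ne_one_of_sin_ne_zero {x : ℝ} (hx : Real.sin x ≠ 0) : Real.cos x ^ 2 ≠ 1 := by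
  intro h
  have := Real.sin_sq_add_cos_sq x
  rw [h] at this
  exact hx (pow_eq_zero_iff two_ne_zero |>.1 (by linarith))

lemma IB_le_of_forall_le {a₁ a₂ a₃ β ω σ C : ℝ}
    (h : ∀ u ∈ Icc (-1 : ℝ) 1, ∀ v ∈ Icc (-1 : ℝ) 1, 0 < σ * symbolDiff a₁ a₂ a₃ β ω u v)
    (hC : ∀ u ∈ Icc (-1 : ℝ) 1, ∀ v ∈ Icc (-1 : ℝ) 1,
      cosQuot (Real.cos β) (ω * a₃) / symbolDiff a₁ a₂ a₃ β ω u v ≤ C) :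
    IB a₁ a₂ a₃ β ω ≤ C := by
  have hle := setIntegral_mono_on (integrableOn_ratio h)
    (integrableOn_const (C := C) volume_square_ne_top) measurableSet_square
    fun p _ => hC _ (Real.cos_mem_Icc p.1) _ (Real.cos_mem_Icc p.2)
  rw [setIntegral_const, volume_real_square, smul_eq_mul] at hle
  rw [IB_eq]
  calc _ ≤ 1 / (4 * π ^ 2) * (4 * π ^ 2 * C) := by gcongr
    _ = C := by field_simp

lemma MonotoneOn.tendsto_atTop_nhdsLT {f : ℝ → ℝ} {l r : ℝ} (hf : MonotoneOn f (Ioo l r))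
    (h : ∀ M, ∃ ω ∈ Ioo l r, M < f ω) : Tendsto f (𝓝[<] r) atTop := by
  refine tendsto_atTop.2 fun M => ?_
  obtain ⟨ω₀, hω₀, hM⟩ := h M
  filter_upwards [Ioo_mem_nhdsLT hω₀.2] with ω hω
  exact hM.le.trans (hf hω₀ ⟨hω₀.1.trans hω.1, hω.2⟩ hω.1.le)

lemma eventually_one_sub_FB_le {a₁ a₂ a₃ β l r : ℝ} (ha₁ : 0 < a₁) (ha₂ : 0 < a₂)
    (ha₃ : 0 < a₃) (hlr : l < r) (h₁ : ∀ ω ∈ Ioo l r, Real.sin (ω * a₁) ≠ 0)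
    (h₂ : ∀ ω ∈ Ioo l r, Real.sin (ω * a₂) ≠ 0) (h₃ : ∀ ω ∈ Ioo l r, Real.sin (ω * a₃) ≠ 0)
    (hG : ∀ ω ∈ Ioo l r, ∀ u ∈ Icc (-1 : ℝ) 1, ∀ v ∈ Icc (-1 : ℝ) 1,
      symbolDiff a₁ a₂ a₃ β ω u v ≠ 0)
    (hs : Real.sin (r * a₁) = 0 ∨ Real.sin (r * a₂) = 0) {ε : ℝ} (hε : 0 < ε) :
    ∀ᶠ ω in 𝓝[<] r, 1 - FB a₁ a₂ a₃ β ω ≤ ε := by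
  have h0mem : (0 : ℝ) ∈ Icc (-1 : ℝ) 1 := by norm_num
  have hJ : ∀ᶠ ω in 𝓝[<] r, ω ∈ Ioo l r := Ioo_mem_nhdsLT hlr
  have hpos : ∀ ω ∈ Ioo l r, ∀ u ∈ Icc (-1 : ℝ) 1, ∀ v ∈ Icc (-1 : ℝ) 1,
      0 < 1 * symbolDiff a₁ a₂ a₃ β ω u v := by
    obtain ⟨σ, hσ | hσ, h⟩ := exists_sign_symbolDiff h₁ h₂ h₃ hG
    · exact hσ ▸ h
    · have ht := tendsto_symbolDiff_atTop (β := β) ha₁ ha₂ ha₃ hlr h₁ h₂ h₃ h0mem h0mem hs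
        (by norm_num) (by norm_num)
      obtain ⟨ω, hω, hω'⟩ := ((ht.eventually_gt_atTop 0).and hJ).exists
      have := h ω hω' 0 h0mem 0 h0mem
      rw [hσ] at this
      linarith
  set ω₁ := (l + r) / 2 with hω₁def
  have hω₁ : ω₁ ∈ Ioo l r := ⟨by linarith, by linarith⟩
  have hJ₁ : ∀ᶠ ω in 𝓝[<] r, ω ∈ Ioo ω₁ r := Ioo_mem_nhdsLT hω₁.2
  have hmono₁ := fun {u} (hu : u ∈ Icc (-1 : ℝ) 1) => monotoneOn_cosQuot ha₁ hu h₁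
  have hmono₂ := fun {u} (hu : u ∈ Icc (-1 : ℝ) 1) => monotoneOn_cosQuot ha₂ hu h₂
  have hmono₃ := monotoneOn_cosQuot ha₃ (Real.cos_mem_Icc β) h₃
  have hp : ∀ ω ∈ Ioo l r, 0 < cosQuot (Real.cos β) (ω * a₃) := fun ω hω => by
    simpa using sign_mul_cosQuot_pos (hpos ω hω)
  by_cases hbdd : ∃ P, ∀ ω ∈ Ioo l r, cosQuot (Real.cos β) (ω * a₃) ≤ P
  · obtain ⟨P, hP⟩ := hbdd
    have hcont : Continuous fun p : ℝ × ℝ => symbolDiff a₁ a₂ a₃ β ω₁ p.1 p.2 := by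
      unfold symbolDiff cosQuot; fun_prop
    obtain ⟨q, hq, hmin⟩ := (isCompact_Icc.prod isCompact_Icc).exists_isMinOn
      (s := Icc (-1 : ℝ) 1 ×ˢ Icc (-1 : ℝ) 1) ⟨(0, 0), h0mem, h0mem⟩ hcont.continuousOn
    set δ := symbolDiff a₁ a₂ a₃ β ω₁ q.1 q.2
    have hδ : 0 < δ := by simpa using hpos ω₁ hω₁ _ hq.1 _ hq.2
    have hδle : ∀ ω ∈ Ioo ω₁ r, ∀ u ∈ Icc (-1 : ℝ) 1, ∀ v ∈ Icc (-1 : ℝ) 1,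
        δ ≤ symbolDiff a₁ a₂ a₃ β ω u v := by
      intro ω hω u hu v hv
      have hω' : ω ∈ Ioo l r := ⟨hω₁.1.trans hω.1, hω.2⟩
      exact (isMinOn_iff.1 hmin (u, v) ⟨hu, hv⟩).trans (add_le_add (add_le_add
        (hmono₁ hu hω₁ hω' hω.1.le) (hmono₂ hv hω₁ hω' hω.1.le)) (hmono₃ hω₁ hω' hω.1.le))
    have hlim : Tendsto (fun ω => ∫ p in (Ioo (0 : ℝ) (2 * π)) ×ˢ (Ioo (0 : ℝ) (2 * π)),
        cosQuot (Real.cos β) (ω * a₃) /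
          symbolDiff a₁ a₂ a₃ β ω (Real.cos p.1) (Real.cos p.2)) (𝓝[<] r)
        (𝓝 (∫ _ in (Ioo (0 : ℝ) (2 * π)) ×ˢ (Ioo (0 : ℝ) (2 * π)), (0 : ℝ))) := by
      refine tendsto_integral_filter_of_dominated_convergence (fun _ => P / δ) ?_ ?_
        (integrableOn_const volume_square_ne_top) ?_
      · filter_upwards [hJ] with ω hω
        exact (integrableOn_ratio (hpos ω hω)).aestronglyMeasurable
      · filter_upwards [hJ₁] with ω hω
        have hω' : ω ∈ Ioo l r := ⟨hω₁.1.trans hω.1, hω.2⟩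
        refine Eventually.of_forall fun p => ?_
        rw [Real.norm_of_nonneg (ratio_pos (hpos ω hω') p).le]
        exact div_le_div₀ ((hp ω hω').le.trans (hP ω hω')) (hP ω hω') hδ
          (hδle ω hω _ (Real.cos_mem_Icc _) _ (Real.cos_mem_Icc _))
      · refine ae_restrict_of_ae ?_
        rw [Measure.volume_eq_prod]
        filter_upwards [Measure.quasiMeasurePreserving_fst.ae ae_sin_ne_zero,
          Measure.quasiMeasurePreserving_snd.ae ae_sin_ne_zero] with p hp1 hp2
        have ht := tendsto_symbolDiff_atTop (β := β) ha₁ ha₂ ha₃ hlr h₁ h₂ h₃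
          (Real.cos_mem_Icc p.1) (Real.cos_mem_Icc p.2) hs (cos_sq_ne_one_of_sin_ne_zero hp1)
          (cos_sq_ne_one_of_sin_ne_zero hp2)
        refine squeeze_zero' ?_ ?_ (ht.const_div_atTop P)
        · filter_upwards [hJ] with ω hω using (ratio_pos (hpos ω hω) p).le
        · filter_upwards [hJ, ht.eventually_gt_atTop 0] with ω hω hω0
          exact div_le_div_of_nonneg_right (hP ω hω) hω0.le
    have hI : Tendsto (fun ω => IB a₁ a₂ a₃ β ω) (𝓝[<] r) (𝓝 0) := by
      rw [integral_zero] at hlim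
      simpa only [IB_eq, mul_zero] using hlim.const_mul (1 / (4 * π ^ 2))
    filter_upwards [hJ, hI.eventually_lt_const one_pos] with ω hω hω1
    have : 1 ≤ FB a₁ a₂ a₃ β ω := (one_le_inv₀ (IB_pos (hpos ω hω))).2 hω1.le
    linarith
  · push Not at hbdd
    have hptop := hmono₃.tendsto_atTop_nhdsLT hbdd
    set m := 2 / |Real.sin (ω₁ * a₁)| + 2 / |Real.sin (ω₁ * a₂)| with hm
    have hm0 : 0 ≤ m := by positivity
    filter_upwards [hJ₁, hptop.eventually_gt_atTop m, hptop.eventually_ge_atTop (m / ε)]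
      with ω hω hωm hωε
    have hω' : ω ∈ Ioo l r := ⟨hω₁.1.trans hω.1, hω.2⟩
    have hpω := hp ω hω'
    set p := cosQuot (Real.cos β) (ω * a₃)
    have hI : IB a₁ a₂ a₃ β ω ≤ p / (p - m) := by
      refine IB_le_of_forall_le (hpos ω hω') fun u hu v hv => ?_
      refine div_le_div_of_nonneg_left hpω.le (sub_pos.2 hωm) ?_
      have e1 := hmono₁ hu hω₁ hω' hω.1.le
      have e2 := hmono₂ hv hω₁ hω' hω.1.le
      have e3 := abs_le.1 (abs_cosQuot_le hu (ω₁ * a₁))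
      have e4 := abs_le.1 (abs_cosQuot_le hv (ω₁ * a₂))
      have e5 : symbolDiff a₁ a₂ a₃ β ω u v = cosQuot u (ω * a₁) + cosQuot v (ω * a₂) + p := rfl
      simp only at e1 e2
      linarith [e3.1, e4.1]
    have hF : (p / (p - m))⁻¹ ≤ FB a₁ a₂ a₃ β ω := inv_anti₀ (IB_pos (hpos ω hω')) hI
    have hmp : m / p ≤ ε := by
      rw [div_le_iff₀ hpω]
      rw [div_le_iff₀ hε] at hωε
      linarith
    rw [inv_div, sub_div, div_self hpω.ne'] at hF
    linarith

lemma limsup_le_zero_of_forall_eventually_le {α : Type*} {F : Filter α} {f : α → ℝ}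
    (h : ∀ ε > 0, ∀ᶠ x in F, f x ≤ ε) : limsup f F ≤ 0 := by
  rw [limsup_eq]
  by_cases hb : BddBelow {a | ∀ᶠ x in F, f x ≤ a}
  · exact le_of_forall_pos_le_add fun ε hε => by
      rw [zero_add]
      exact csInf_le hb (h ε hε)
  · rw [Real.sInf_of_not_bddBelow hb]

lemma sin_mul_ne_zero_of_notMem_dispSet {a₁ a₂ a₃ β ω : ℝ} (hω : 0 < ω)
    (h : ω ∉ dispSet a₁ a₂ a₃ β) : Real.sin (ω * a₁) ≠ 0 ∧ Real.sin (ω * a₂) ≠ 0 := by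
  have key : ∀ a, ∃ k ∈ Icc (0 : ℝ) π, Real.cos (ω * a) - Real.cos k = 0 := fun a =>
    ⟨Real.arccos (Real.cos (ω * a)), ⟨Real.arccos_nonneg _, Real.arccos_le_pi _⟩, by
      rw [Real.cos_arccos (Real.neg_one_le_cos _) (Real.cos_le_one _), sub_self]⟩
  obtain ⟨k₁, hk₁, e₁⟩ := key a₁
  obtain ⟨k₂, hk₂, e₂⟩ := key a₂
  constructor <;> intro hs <;> exact h ⟨hω, k₁, hk₁, k₂, hk₂, by simp [Dfun, hs, e₁, e₂]⟩

lemma mem_nat_mul_pi_div_iff {a ω : ℝ} (ha : 0 < a) (hω : 0 < ω) :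
    (∃ n : ℕ, 1 ≤ n ∧ ω = π * n / a) ↔ Real.sin (ω * a) = 0 := by
  constructor
  · rintro ⟨n, -, rfl⟩
    rw [div_mul_cancel₀ _ ha.ne', mul_comm, Real.sin_nat_mul_pi]
  · intro h
    obtain ⟨n, hn⟩ := Real.sin_eq_zero_iff.1 h
    have hn0 : (0 : ℝ) < n := by
      by_contra! hle
      nlinarith [Real.pi_pos, mul_pos hω ha]
    have hn1 : 0 < n := by exact_mod_cast hn0
    lift n to ℕ using hn1.le
    refine ⟨n, by exact_mod_cast hn1, ?_⟩
    rw [eq_div_iff ha.ne', ← hn, mul_comm]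
    simp

lemma mem_Tset_iff {a₁ a₂ ω : ℝ} (ha₁ : 0 < a₁) (ha₂ : 0 < a₂) (hω : 0 < ω) :
    ω ∈ Tset a₁ a₂ ↔ Real.sin (ω * a₁) = 0 ∨ Real.sin (ω * a₂) = 0 := by
  rw [← mem_nat_mul_pi_div_iff ha₁ hω, ← mem_nat_mul_pi_div_iff ha₂ hω]
  rfl

lemma symbolDiff_eq_zero_of_Dfun_eq_zero {a₁ a₂ a₃ β ω k₁ k₂ : ℝ}
    (h₁ : Real.sin (ω * a₁) ≠ 0) (h₂ : Real.sin (ω * a₂) ≠ 0) (h₃ : Real.sin (ω * a₃) ≠ 0)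
    (hD : Dfun a₁ a₂ a₃ β ω k₁ k₂ = 0) :
    symbolDiff a₁ a₂ a₃ β ω (Real.cos k₁) (Real.cos k₂) = 0 := by
  unfold symbolDiff cosQuot
  unfold Dfun at hD
  field_simp
  linear_combination -hD

/-- in a gap of type (iii), `F_β → 0` at the bottom of the gap and
`limsup (1 − F_β) ≤ 0` at the top. -/
theorem stmt12 (a₁ a₂ a₃ β : ℝ) (ha₁ : 0 < a₁) (ha₂ : 0 < a₂) (ha₃ : 0 < a₃)
    (hβ : β ∈ Icc (0 : ℝ) π) (ωb ωt : ℝ) (hgap : IsGap a₁ a₂ a₃ β ωb ωt)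
    (hb : ωb ∉ Tset a₁ a₂) (ht : ωt ∈ Tset a₁ a₂)
    (hW : Ioo ωb ωt ∩ Wset a₃ β = ∅) :
    Tendsto (fun ω => FB a₁ a₂ a₃ β ω) (𝓝[Ioo ωb ωt] ωb) (𝓝 0) ∧
    limsup (fun ω => 1 - FB a₁ a₂ a₃ β ω) (𝓝[Ioo ωb ωt] ωt) ≤ 0 := by
  obtain ⟨hb0, hbt, ⟨-, k₁, hk₁, k₂, hk₂, hD⟩, -, hempty⟩ := hgap
  have hnot : ∀ ω ∈ Ioo ωb ωt, ω ∉ dispSet a₁ a₂ a₃ β := fun ω hω hmem =>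
    (hempty ▸ (⟨hω, hmem⟩ : ω ∈ Ioo ωb ωt ∩ dispSet a₁ a₂ a₃ β) : ω ∈ (∅ : Set ℝ))
  have hs : ∀ ω ∈ Ioo ωb ωt, Real.sin (ω * a₁) ≠ 0 ∧ Real.sin (ω * a₂) ≠ 0 := fun ω hω =>
    sin_mul_ne_zero_of_notMem_dispSet (hb0.trans hω.1) (hnot ω hω)
  have hG : ∀ ω ∈ Ioo ωb ωt, Real.sin (ω * a₃) ≠ 0 → ∀ u ∈ Icc (-1 : ℝ) 1,
      ∀ v ∈ Icc (-1 : ℝ) 1, symbolDiff a₁ a₂ a₃ β ω u v ≠ 0 := fun ω hω h₃ u hu v hv =>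
    symbolDiff_ne_zero (hb0.trans hω.1) (hnot ω hω) (hs ω hω).1 (hs ω hω).2 h₃ hu hv
  constructor
  · rw [nhdsWithin_Ioo_eq_nhdsGT hbt]
    rw [mem_Tset_iff ha₁ ha₂ hb0, not_or] at hb
    obtain ⟨r, hr, hsub⟩ := mem_nhdsGT_iff_exists_Ioo_subset.1
      (inter_mem (Ioo_mem_nhdsGT hbt)
        ((eventually_sin_mul_ne_zero ha₃.ne' ωb).filter_mono
          (nhdsWithin_mono _ fun x hx => ne_of_gt hx)))
    obtain ⟨σ, hσ, hpos⟩ := exists_sign_symbolDiff (β := β)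
      (fun ω hω => (hs ω (hsub hω).1).1) (fun ω hω => (hs ω (hsub hω).1).2)
      (fun ω hω => (hsub hω).2) (fun ω hω => hG ω (hsub hω).1 (hsub hω).2)
    have hσ0 : σ ≠ 0 := by rcases hσ with rfl | rfl <;> norm_num
    have h₃ := sin_third_ne_zero hr hb.1 hb.2 hD hpos
    exact tendsto_FB_nhdsGT hr hb.1 hb.2 h₃ hσ0 hk₁ hk₂
      (symbolDiff_eq_zero_of_Dfun_eq_zero hb.1 hb.2 h₃ hD) hpos
  · rw [nhdsWithin_Ioo_eq_nhdsLT hbt]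
    obtain ⟨l, hl, hsub⟩ := mem_nhdsLT_iff_exists_Ioo_subset.1
      (inter_mem (Ioo_mem_nhdsLT hbt)
        ((eventually_sin_mul_ne_zero ha₃.ne' ωt).filter_mono
          (nhdsWithin_mono _ fun x hx => ne_of_lt hx)))
    exact limsup_le_zero_of_forall_eventually_le fun ε hε =>
      eventually_one_sub_FB_le ha₁ ha₂ ha₃ hl
        (fun ω hω => (hs ω (hsub hω).1).1) (fun ω hω => (hs ω (hsub hω).1).2)
        (fun ω hω => (hsub hω).2) (fun ω hω => hG ω (hsub hω).1 (hsub hω).2)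
        ((mem_Tset_iff ha₁ ha₂ (hb0.trans hbt)).1 ht) hε
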